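/- Let l ≥ 3 be odd and let R be a Poisson subalgebra of P containing H₁ and H_l. Then H_m ⊆ R for every odd m with 1 ≤ m ≤ 2l−1; in other words, R contains all odd polynomials of degree at most 2l−1. -/

import Mathlib

open MvPolynomial MeasureTheory

noncomputable section

attribute [local instance] Classical.propDecidable

/-- The Poisson bracket on `ℝ[X₀,X₁,X₂]` associated to the sphere:
`{f,g} = Σ εᵢⱼₖ Xᵢ ∂f/∂Xⱼ ∂g/∂Xₖ` (indices `0,1,2` play the role of `1,2,3`). -/
def pb (f g : MvPolynomial (Fin 3) ℝ) : MvPolynomial (Fin 3) ℝ :=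
  X 0 * (pderiv 1 f * pderiv 2 g - pderiv 2 f * pderiv 1 g) +
  X 1 * (pderiv 2 f * pderiv 0 g - pderiv 0 f * pderiv 2 g) +
  X 2 * (pderiv 0 f * pderiv 1 g - pderiv 1 f * pderiv 0 g)

/-- The ideal generated by `X₀² + X₁² + X₂² - s²`. -/
def sphereIdeal (s : ℝ) : Ideal (MvPolynomial (Fin 3) ℝ) :=
  Ideal.span {X 0 ^ 2 + X 1 ^ 2 + X 2 ^ 2 - C (s ^ 2)}

/-- The Poisson algebra `P` of polynomial functions on the sphere of radius `s`. -/
abbrev SpherePoly (s : ℝ) := MvPolynomial (Fin 3) ℝ ⧸ sphereIdeal s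

/-- The quotient map `ℝ[X₀,X₁,X₂] → P`. -/
def toSphere (s : ℝ) : MvPolynomial (Fin 3) ℝ →+* SpherePoly s :=
  Ideal.Quotient.mk (sphereIdeal s)

/-- The components `S₁, S₂, S₃` of the spin vector (indexed by `Fin 3`). -/
def S (s : ℝ) (i : Fin 3) : SpherePoly s := toSphere s (X i)

/-- A choice of polynomial representative of an element of `P`. -/
def rep (s : ℝ) (p : SpherePoly s) : MvPolynomial (Fin 3) ℝ :=
  (Ideal.Quotient.mk_surjective (I := sphereIdeal s) p).choose

/-- The Poisson bracket descended to `P`.  (It is independent of the choice of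
representatives, since the bracket of any polynomial with the generator
`X₀² + X₁² + X₂² - s²` vanishes identically.) -/
def pbS (s : ℝ) (p q : SpherePoly s) : SpherePoly s :=
  toSphere s (pb (rep s p) (rep s q))

/-- The Laplacian on `ℝ[X₀,X₁,X₂]` as a linear map. -/
def laplacian : MvPolynomial (Fin 3) ℝ →ₗ[ℝ] MvPolynomial (Fin 3) ℝ :=
  (pderiv 0).toLinearMap ∘ₗ (pderiv 0).toLinearMap +
  (pderiv 1).toLinearMap ∘ₗ (pderiv 1).toLinearMap +
  (pderiv 2).toLinearMap ∘ₗ (pderiv 2).toLinearMap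

/-- Homogeneous harmonic polynomials of degree `l`. -/
def harmonicHomog (l : ℕ) : Submodule ℝ (MvPolynomial (Fin 3) ℝ) :=
  homogeneousSubmodule (Fin 3) ℝ l ⊓ LinearMap.ker laplacian

/-- `H_l`, the image in `P` of the homogeneous harmonic polynomials of degree `l`. -/
def Hsph (s : ℝ) (l : ℕ) : Submodule ℝ (SpherePoly s) :=
  (harmonicHomog l).map (Ideal.Quotient.mkₐ ℝ (sphereIdeal s)).toLinearMap

/-- `O`, the odd polynomials: the sum of the `H_l` over odd `l`. -/
def Osph (s : ℝ) : Submodule ℝ (SpherePoly s) :=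
  ⨆ (l : ℕ) (_ : Odd l), Hsph s l

/-- `Õ = ℝ·1 ⊕ O`. -/
def Otilde (s : ℝ) : Submodule ℝ (SpherePoly s) :=
  Submodule.span ℝ ({1} : Set (SpherePoly s)) ⊔ Osph s

theorem S_mem_H1 (s : ℝ) (i : Fin 3) : S s i ∈ Hsph s 1 := by
  refine ⟨X i, ⟨isHomogeneous_X _ _, ?_⟩, rfl⟩
  fin_cases i <;> simp [laplacian, pderiv_X]

theorem S_mem_Otilde (s : ℝ) (i : Fin 3) : S s i ∈ Otilde s :=
  Submodule.mem_sup_right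
    ((le_iSup₂ (f := fun (l : ℕ) (_ : Odd l) => Hsph s l) 1 odd_one) (S_mem_H1 s i))

theorem one_mem_Otilde (s : ℝ) : (1 : SpherePoly s) ∈ Otilde s :=
  Submodule.mem_sup_left (Submodule.mem_span_singleton_self 1)


/-- Integration of a real polynomial over `[-s, s]`, as a linear functional. -/
def symmIntegral (s : ℝ) : Polynomial ℝ →ₗ[ℝ] ℝ where
  toFun q := ∫ x in (-s)..s, q.eval x
  map_add' p q := by
    simp only [Polynomial.eval_add]
    exact intervalIntegral.integral_add (p.continuous.intervalIntegrable _ _)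
      (q.continuous.intervalIntegrable _ _)
  map_smul' a q := by
    simp [Polynomial.eval_smul]

theorem symmIntegral_derivative (s : ℝ) (q : Polynomial ℝ) :
    symmIntegral s (Polynomial.derivative q) = q.eval s - q.eval (-s) :=
  intervalIntegral.integral_eq_sub_of_hasDerivAt (fun x _ => q.hasDerivAt x)
    ((Polynomial.derivative q).continuous.intervalIntegrable _ _)

theorem symmIntegral_mul_self_pos {s : ℝ} (hs : 0 < s) {q : Polynomial ℝ} (hq : q ≠ 0) :
    0 < symmIntegral s (q * q) := by
  refine intervalIntegral.integral_pos (by linarith) (q * q).continuous.continuousOn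
    (fun x _ => by simpa using mul_self_nonneg (q.eval x)) ?_
  by_contra! h
  refine hq (q.eq_zero_of_infinite_isRoot ?_)
  refine (Set.Icc_infinite (by linarith : -s < s)).mono fun x hx => ?_
  have := h x hx
  rw [Polynomial.eval_mul] at this
  exact mul_self_eq_zero.1 (le_antisymm this (mul_self_nonneg _))

/-- The polynomial `s² - X²`, vanishing at the endpoints of `[-s, s]`. -/
def sqSub (s : ℝ) : Polynomial ℝ := Polynomial.C (s ^ 2) - Polynomial.X ^ 2

theorem derivative_sqSub (s : ℝ) :
    Polynomial.derivative (sqSub s) = -(2 * Polynomial.X) := by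
  rw [sqSub, Polynomial.derivative_sub, Polynomial.derivative_C, Polynomial.derivative_X_sq,
    zero_sub, Polynomial.C_ofNat]

theorem eval_sqSub {s x : ℝ} (hx : x ^ 2 = s ^ 2) : (sqSub s).eval x = 0 := by
  simp [sqSub, hx]

theorem symmIntegral_derivative_sqSub_mul (s : ℝ) (q : Polynomial ℝ) :
    symmIntegral s (Polynomial.derivative (sqSub s * q)) = 0 := by
  rw [symmIntegral_derivative, Polynomial.eval_mul, Polynomial.eval_mul, eval_sqSub rfl,
    eval_sqSub (neg_sq s), zero_mul, zero_mul, sub_zero]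

theorem natDegree_sqSub_pow (s : ℝ) (l : ℕ) : (sqSub s ^ l).natDegree = 2 * l := by
  have : (sqSub s).natDegree = 2 := by
    unfold sqSub
    compute_degree!
  rw [Polynomial.natDegree_pow, this, mul_comm]

theorem iterate_derivative_sqSub_pow_ne_zero {s : ℝ} {l k : ℕ} (hk : k ≤ 2 * l) :
    Polynomial.derivative^[k] (sqSub s ^ l) ≠ 0 := by
  intro h
  have h0 : sqSub s ^ l ≠ 0 := by
    refine pow_ne_zero _ fun h => ?_
    simpa [h] using natDegree_sqSub_pow s 1
  have h1 := congrArg (fun p => Polynomial.coeff p (2 * l - k)) h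
  simp only [Polynomial.coeff_iterate_derivative, Nat.sub_add_cancel hk, Polynomial.coeff_zero,
    nsmul_eq_mul, mul_eq_zero, Nat.cast_eq_zero, Nat.descFactorial_eq_zero_iff_lt] at h1
  rcases h1 with h1 | h1
  · omega
  · rw [← natDegree_sqSub_pow s l] at h1
    exact h0 (Polynomial.leadingCoeff_eq_zero.1 h1)

theorem sqSub_dvd_iterate_derivative (s : ℝ) {l k : ℕ} (hk : k < l) :
    sqSub s ∣ Polynomial.derivative^[k] (sqSub s ^ l) :=
  (dvd_pow_self _ (by omega : l - k ≠ 0)).trans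
    (Polynomial.pow_sub_dvd_iterate_derivative_of_pow_dvd k dvd_rfl)

theorem symmIntegral_iterate_derivative_succ_mul (s : ℝ) {l a b : ℕ} (h : a + b < 2 * l) :
    symmIntegral s (Polynomial.derivative^[a + 1] (sqSub s ^ l) *
      Polynomial.derivative^[b] (sqSub s ^ l)) =
    -symmIntegral s (Polynomial.derivative^[a] (sqSub s ^ l) *
      Polynomial.derivative^[b + 1] (sqSub s ^ l)) := by
  have hdvd : sqSub s ∣ Polynomial.derivative^[a] (sqSub s ^ l) *
      Polynomial.derivative^[b] (sqSub s ^ l) := by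
    rcases lt_or_ge a l with ha | ha
    · exact (sqSub_dvd_iterate_derivative s ha).mul_right _
    · exact (sqSub_dvd_iterate_derivative s (by omega)).mul_left _
  obtain ⟨r, hr⟩ := hdvd
  have := symmIntegral_derivative_sqSub_mul s r
  rw [← hr, Polynomial.derivative_mul, map_add] at this
  simp only [Function.iterate_succ_apply']
  linarith

theorem symmIntegral_derivative_mul_iterate_derivative_ne_zero {s : ℝ} (hs : 0 < s) {l k : ℕ}
    (hk : Odd k) (hkl : k < 2 * l) :
    symmIntegral s (Polynomial.derivative (sqSub s ^ l) *
      Polynomial.derivative^[k] (sqSub s ^ l)) ≠ 0 := by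
  obtain ⟨j, rfl⟩ := hk
  have shift : ∀ i ≤ j, symmIntegral s (Polynomial.derivative^[j + 1] (sqSub s ^ l) *
      Polynomial.derivative^[j + 1] (sqSub s ^ l)) =
      (-1) ^ i * symmIntegral s (Polynomial.derivative^[j - i + 1] (sqSub s ^ l) *
      Polynomial.derivative^[j + i + 1] (sqSub s ^ l)) := by
    intro i
    induction i with
    | zero => simp
    | succ i ih =>
      intro hi
      rw [ih (by omega), show j - i + 1 = (j - (i + 1) + 1) + 1 by omega,
        symmIntegral_iterate_derivative_succ_mul s (by omega), pow_succ,
        show j + (i + 1) + 1 = j + i + 1 + 1 by omega]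
      ring
  have hpos := symmIntegral_mul_self_pos hs
    (iterate_derivative_sqSub_pow_ne_zero (s := s) (show j + 1 ≤ 2 * l by omega))
  intro h
  rw [shift j le_rfl, Nat.sub_self, show j + j + 1 = 2 * j + 1 by omega, zero_add,
    Function.iterate_one, h, mul_zero] at hpos
  exact hpos.false

theorem symmIntegral_sqSub_pow_mul_derivative (s : ℝ) (n : ℕ) (q : Polynomial ℝ) :
    symmIntegral s (sqSub s ^ (n + 1) * Polynomial.derivative q) =
      2 * (n + 1) * symmIntegral s (Polynomial.X * (sqSub s ^ n * q)) := by
  have h := symmIntegral_derivative_sqSub_mul s (sqSub s ^ n * q)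
  have e : Polynomial.derivative (sqSub s * (sqSub s ^ n * q)) =
      sqSub s ^ (n + 1) * Polynomial.derivative q -
        (2 * (n + 1) : ℝ) • (Polynomial.X * (sqSub s ^ n * q)) := by
    rw [← mul_assoc, ← pow_succ', Polynomial.derivative_mul, Polynomial.derivative_pow_succ,
      derivative_sqSub, Polynomial.smul_eq_C_mul]
    simp only [map_mul, map_add, map_natCast, map_one, map_ofNat]
    ring
  rw [e, map_sub, map_smul, smul_eq_mul] at h
  linarith

theorem symmIntegral_X_mul_sqSub_pow_mul_ne_zero {s : ℝ} (hs : 0 < s) {n k : ℕ}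
    (hk : Odd k) (hkn : k < 2 * (n + 1)) :
    symmIntegral s (Polynomial.X *
      (sqSub s ^ n * Polynomial.derivative^[k] (sqSub s ^ (n + 1)))) ≠ 0 := by
  intro h
  refine symmIntegral_derivative_mul_iterate_derivative_ne_zero hs hk hkn ?_
  have e : Polynomial.derivative (sqSub s ^ (n + 1)) *
      Polynomial.derivative^[k] (sqSub s ^ (n + 1)) = (-(2 * (n + 1)) : ℝ) • (Polynomial.X *
      (sqSub s ^ n * Polynomial.derivative^[k] (sqSub s ^ (n + 1)))) := by
    rw [Polynomial.derivative_pow_succ, derivative_sqSub, Polynomial.smul_eq_C_mul]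
    simp only [map_mul, map_add, map_neg, map_natCast, map_one, map_ofNat]
    ring
  rw [e, map_smul, h, smul_zero]

/-- The lowering operator on the coefficient `q(X₂)` of a function `zᵐ q(X₂)` on the sphere. -/
def lowering (s : ℝ) (m : ℕ) (q : Polynomial ℝ) : Polynomial ℝ :=
  sqSub s * Polynomial.derivative q - (2 * m : ℝ) • (Polynomial.X * q)

theorem sqSub_pow_mul_lowering (s : ℝ) (n : ℕ) (q : Polynomial ℝ) :
    sqSub s ^ n * lowering s (n + 1) q = Polynomial.derivative (sqSub s ^ (n + 1) * q) := by
  rw [lowering, Polynomial.derivative_mul, Polynomial.derivative_pow_succ, derivative_sqSub,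
    Polynomial.smul_eq_C_mul]
  simp only [map_mul, map_add, map_natCast, map_one, map_ofNat, Nat.cast_add, Nat.cast_one]
  ring

theorem symmIntegral_sqSub_pow_mul_derivative_lowering (s : ℝ) (m : ℕ) (q : Polynomial ℝ) :
    symmIntegral s (sqSub s ^ m * Polynomial.derivative (lowering s m q)) =
      -(2 * m) * symmIntegral s (sqSub s ^ m * q) := by
  have h := symmIntegral_derivative_sqSub_mul s (sqSub s ^ m * Polynomial.derivative q)
  have e : Polynomial.derivative (sqSub s * (sqSub s ^ m * Polynomial.derivative q)) =
      sqSub s ^ m * Polynomial.derivative (lowering s m q) +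
        (2 * m : ℝ) • (sqSub s ^ m * q) := by
    rw [← mul_assoc, ← pow_succ', lowering, Polynomial.derivative_mul,
      Polynomial.derivative_pow_succ, derivative_sqSub, Polynomial.derivative_sub,
      Polynomial.derivative_smul, Polynomial.derivative_mul, Polynomial.derivative_mul,
      derivative_sqSub, Polynomial.derivative_X, Polynomial.smul_eq_C_mul,
      Polynomial.smul_eq_C_mul]
    simp only [map_mul, map_add, map_natCast, map_one, map_ofNat]
    ring
  rw [e, map_add, map_smul, smul_eq_mul] at h
  linarith

theorem coeff_derivative_lowering (s : ℝ) (m n : ℕ) (q : Polynomial ℝ) :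
    (Polynomial.derivative (lowering s m q)).coeff n =
      (n + 1) * (s ^ 2 * ((n + 2) * q.coeff (n + 2)) - (n + 2 * m) * q.coeff n) := by
  have h : lowering s m q = Polynomial.C (s ^ 2) * Polynomial.derivative q -
      Polynomial.X * (Polynomial.X * Polynomial.derivative q) -
      Polynomial.X * (Polynomial.C (2 * m : ℝ) * q) := by
    rw [lowering, sqSub, Polynomial.smul_eq_C_mul]
    ring
  have h' : (Polynomial.X * Polynomial.derivative q).coeff n = n * q.coeff n := by
    cases n with
    | zero => simp
    | succ n =>
      rw [Polynomial.coeff_X_mul, Polynomial.coeff_derivative]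
      push_cast
      ring
  rw [Polynomial.coeff_derivative, h, Polynomial.coeff_sub, Polynomial.coeff_sub,
    Polynomial.coeff_C_mul, Polynomial.coeff_X_mul, Polynomial.coeff_X_mul, h',
    Polynomial.coeff_C_mul, Polynomial.coeff_derivative]
  push_cast
  ring

/-- A space of polynomials stable under the (shifted) Gegenbauer operator and not orthogonal to
the constants contains the constants. -/
theorem one_mem_of_derivative_lowering_mem (s : ℝ) (m : ℕ) (W : Submodule ℝ (Polynomial ℝ))
    (hW : ∀ q ∈ W, Polynomial.derivative (lowering s m q) ∈ W) {q : Polynomial ℝ} (hq : q ∈ W)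
    (hq0 : symmIntegral s (sqSub s ^ m * q) ≠ 0) : (1 : Polynomial ℝ) ∈ W := by
  suffices ∀ d : ℕ, ∀ q ∈ W, q.natDegree ≤ d → symmIntegral s (sqSub s ^ m * q) ≠ 0 →
      (1 : Polynomial ℝ) ∈ W from this _ q hq le_rfl hq0
  intro d
  induction d with
  | zero =>
    intro q hq hd h0
    rw [Polynomial.eq_C_of_natDegree_le_zero hd] at hq h0
    have hc : q.coeff 0 ≠ 0 := by
      rintro hc
      simp [hc] at h0
    have := W.smul_mem (q.coeff 0)⁻¹ hq
    rwa [Polynomial.smul_C, smul_eq_mul, inv_mul_cancel₀ hc, Polynomial.C_1] at this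
  | succ d ih =>
    intro q hq hd h0
    refine ih (Polynomial.derivative (lowering s m q) + ((d + 2) * (d + 1 + 2 * m) : ℝ) • q)
      (W.add_mem (hW q hq) (W.smul_mem _ hq)) ?_ ?_
    · rw [Polynomial.natDegree_le_iff_coeff_eq_zero] at hd ⊢
      intro n hn
      rw [Polynomial.coeff_add, coeff_derivative_lowering, hd (n + 2) (by omega),
        Polynomial.coeff_smul, smul_eq_mul]
      rcases (Nat.succ_le_of_lt hn).eq_or_lt with rfl | hn
      · push_cast
        ring
      · rw [hd n hn]
        ring
    · rw [mul_add, map_add, symmIntegral_sqSub_pow_mul_derivative_lowering, mul_smul_comm,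
        map_smul, smul_eq_mul, ← add_mul]
      refine mul_ne_zero (ne_of_gt ?_) h0
      have hd0 : (0 : ℝ) ≤ d := d.cast_nonneg
      have hm0 : (0 : ℝ) ≤ m := m.cast_nonneg
      nlinarith [mul_nonneg hd0 hm0, mul_nonneg hd0 hd0]

/-- The complexified Hamiltonian derivation `{F, ·}` on `ℂ[X₀,X₁,X₂]`. -/
def hamiltonian (F : MvPolynomial (Fin 3) ℂ) :
    Derivation ℂ (MvPolynomial (Fin 3) ℂ) (MvPolynomial (Fin 3) ℂ) :=
  (X 0 : MvPolynomial (Fin 3) ℂ) • (pderiv 1 F • pderiv 2 - pderiv 2 F • pderiv 1) +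
  (X 1 : MvPolynomial (Fin 3) ℂ) • (pderiv 2 F • pderiv 0 - pderiv 0 F • pderiv 2) +
  (X 2 : MvPolynomial (Fin 3) ℂ) • (pderiv 0 F • pderiv 1 - pderiv 1 F • pderiv 0)

theorem hamiltonian_apply (F G : MvPolynomial (Fin 3) ℂ) : hamiltonian F G =
    X 0 * (pderiv 1 F * pderiv 2 G - pderiv 2 F * pderiv 1 G) +
    X 1 * (pderiv 2 F * pderiv 0 G - pderiv 0 F * pderiv 2 G) +
    X 2 * (pderiv 0 F * pderiv 1 G - pderiv 1 F * pderiv 0 G) :=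
  rfl

theorem hamiltonian_swap (F G : MvPolynomial (Fin 3) ℂ) :
    hamiltonian F G = -hamiltonian G F := by
  simp only [hamiltonian_apply]
  ring

theorem hamiltonian_map (f g : MvPolynomial (Fin 3) ℝ) :
    hamiltonian (map Complex.ofRealHom f) (map Complex.ofRealHom g) =
      map Complex.ofRealHom (pb f g) := by
  simp [hamiltonian_apply, pb, pderiv_map]

theorem hamiltonian_add_left (F F' G : MvPolynomial (Fin 3) ℂ) :
    hamiltonian (F + F') G = hamiltonian F G + hamiltonian F' G := by
  rw [hamiltonian_swap, map_add, neg_add, ← hamiltonian_swap, ← hamiltonian_swap]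

theorem hamiltonian_C_mul_left (a : ℂ) (F G : MvPolynomial (Fin 3) ℂ) :
    hamiltonian (C a * F) G = C a * hamiltonian F G := by
  rw [← smul_eq_C_mul, hamiltonian_swap, Derivation.map_smul, ← smul_neg, ← hamiltonian_swap,
    smul_eq_C_mul]

/-- The complex coordinate `X₀ + i X₁`. -/
def coordZ : MvPolynomial (Fin 3) ℂ := X 0 + C Complex.I * X 1

/-- The complex coordinate `X₀ - i X₁`. -/
def coordW : MvPolynomial (Fin 3) ℂ := X 0 - C Complex.I * X 1

theorem C_I_mul_C_I : (C Complex.I * C Complex.I : MvPolynomial (Fin 3) ℂ) = -1 := by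
  rw [← C_mul, Complex.I_mul_I, C_neg, C_1]

theorem hamiltonian_coordW_coordZ :
    hamiltonian coordW coordZ = 2 * C Complex.I * X 2 := by
  simp only [hamiltonian_apply, coordZ, coordW, map_add, map_sub, pderiv_C_mul, pderiv_X]
  simp
  ring

theorem hamiltonian_coordZ_X : hamiltonian coordZ (X 2) = C Complex.I * coordZ := by
  simp only [hamiltonian_apply, coordZ, map_add, pderiv_C_mul, pderiv_X]
  simp
  linear_combination (-X 1) * C_I_mul_C_I

theorem hamiltonian_coordW_X : hamiltonian coordW (X 2) = -(C Complex.I * coordW) := by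
  simp only [hamiltonian_apply, coordW, map_sub, pderiv_C_mul, pderiv_X]
  simp
  linear_combination (-X 1) * C_I_mul_C_I

theorem hamiltonian_self (F : MvPolynomial (Fin 3) ℂ) : hamiltonian F F = 0 := by
  simp only [hamiltonian_apply]
  ring

/-- A real univariate polynomial evaluated at `X₂`. -/
def evalX (q : Polynomial ℝ) : MvPolynomial (Fin 3) ℂ := Polynomial.aeval (X 2) q

theorem hamiltonian_evalX (F : MvPolynomial (Fin 3) ℂ) (q : Polynomial ℝ) :
    hamiltonian F (evalX q) = evalX (Polynomial.derivative q) * hamiltonian F (X 2) :=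
  ((hamiltonian F).restrictScalars ℝ).map_aeval q (X 2)

theorem real_smul_eq_C_mul (a : ℝ) (F : MvPolynomial (Fin 3) ℂ) : a • F = C (a : ℂ) * F := by
  rw [← smul_eq_C_mul, Complex.coe_smul]

theorem evalX_lowering (s : ℝ) (m : ℕ) (q : Polynomial ℝ) :
    evalX (lowering s m q) = evalX (sqSub s) * evalX (Polynomial.derivative q) -
      2 * (m : MvPolynomial (Fin 3) ℂ) * X 2 * evalX q := by
  simp only [evalX, lowering, map_sub, map_smul, map_mul, Polynomial.aeval_X, real_smul_eq_C_mul]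
  push_cast
  simp only [map_mul, map_natCast, map_ofNat]
  ring

theorem evalX_X_pow (j : ℕ) : evalX (Polynomial.X ^ j) = X 2 ^ j := by
  simp [evalX]

theorem evalX_sqSub (s : ℝ) : evalX (sqSub s) = C ((s ^ 2 : ℝ) : ℂ) - X 2 ^ 2 := by
  simp [evalX, sqSub, algebraMap_eq, IsScalarTower.algebraMap_apply ℝ ℂ (MvPolynomial (Fin 3) ℂ)]

/-- The defining relation of the complexified sphere: `z w - (s² - X₂²)`. -/
theorem coordZ_mul_coordW_sub (s : ℝ) : coordZ * coordW - evalX (sqSub s) =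
    map Complex.ofRealHom (X 0 ^ 2 + X 1 ^ 2 + X 2 ^ 2 - C (s ^ 2)) := by
  rw [evalX_sqSub]
  simp [coordZ, coordW]
  linear_combination (-X 1 ^ 2) * C_I_mul_C_I

/-- The complex span of the image of a real space of polynomials. -/
def complexify (T : Submodule ℝ (MvPolynomial (Fin 3) ℝ)) :
    Submodule ℂ (MvPolynomial (Fin 3) ℂ) where
  carrier := {F | ∃ f ∈ T, ∃ g ∈ T, F = map Complex.ofRealHom f +
    C Complex.I * map Complex.ofRealHom g}
  zero_mem' := ⟨0, T.zero_mem, 0, T.zero_mem, by simp⟩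
  add_mem' := by
    rintro _ _ ⟨f, hf, g, hg, rfl⟩ ⟨f', hf', g', hg', rfl⟩
    refine ⟨f + f', T.add_mem hf hf', g + g', T.add_mem hg hg', ?_⟩
    simp only [map_add]
    ring
  smul_mem' := by
    rintro a _ ⟨f, hf, g, hg, rfl⟩
    refine ⟨a.re • f - a.im • g, T.sub_mem (T.smul_mem _ hf) (T.smul_mem _ hg),
      a.im • f + a.re • g, T.add_mem (T.smul_mem _ hf) (T.smul_mem _ hg), ?_⟩
    have ha : (C a : MvPolynomial (Fin 3) ℂ) = C (a.re : ℂ) + C (a.im : ℂ) * C Complex.I := by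
      rw [← C_mul, ← C_add, Complex.re_add_im]
    simp only [smul_eq_C_mul, map_sub, map_add, map_mul, map_C, Complex.ofRealHom_eq_coe, ha]
    linear_combination (C (a.im : ℂ) * map Complex.ofRealHom g) * C_I_mul_C_I

theorem map_mem_complexify {T : Submodule ℝ (MvPolynomial (Fin 3) ℝ)}
    {f : MvPolynomial (Fin 3) ℝ} : map Complex.ofRealHom f ∈ complexify T ↔ f ∈ T := by
  refine ⟨?_, fun hf => ⟨f, hf, 0, T.zero_mem, by simp⟩⟩
  rintro ⟨g, hg, h, -, e⟩
  convert hg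
  ext d
  have := congrArg (fun F => (coeff d F).re) e
  simpa [coeff_map] using this

theorem hamiltonian_mem_complexify {T : Submodule ℝ (MvPolynomial (Fin 3) ℝ)}
    (hT : ∀ f ∈ T, ∀ g ∈ T, pb f g ∈ T) {F G : MvPolynomial (Fin 3) ℂ}
    (hF : F ∈ complexify T) (hG : G ∈ complexify T) : hamiltonian F G ∈ complexify T := by
  obtain ⟨f, hf, g, hg, rfl⟩ := hF
  obtain ⟨f', hf', g', hg', rfl⟩ := hG
  refine ⟨pb f f' - pb g g', T.sub_mem (hT _ hf _ hf') (hT _ hg _ hg'),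
    pb f g' + pb g f', T.add_mem (hT _ hf _ hg') (hT _ hg _ hf'), ?_⟩
  rw [hamiltonian_add_left, hamiltonian_C_mul_left]
  simp only [map_add, map_sub, ← smul_eq_C_mul, Derivation.map_smul, hamiltonian_map]
  simp only [smul_eq_C_mul]
  linear_combination (map Complex.ofRealHom (pb g g')) * C_I_mul_C_I

theorem mul_map_mem_complexify {T : Submodule ℝ (MvPolynomial (Fin 3) ℝ)}
    {n : MvPolynomial (Fin 3) ℝ} (hn : ∀ f, f * n ∈ T) (F : MvPolynomial (Fin 3) ℂ) :
    F * map Complex.ofRealHom n ∈ complexify T := by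
  rw [F.as_sum, Finset.sum_mul]
  refine Submodule.sum_mem _ fun d _ => ?_
  have e : monomial d (coeff d F) = coeff d F • map Complex.ofRealHom (monomial d 1) := by
    simp [smul_monomial]
  rw [e, smul_mul_assoc, ← map_mul]
  exact Submodule.smul_mem _ _ (map_mem_complexify.2 (hn _))

theorem pderiv_pderiv_comm (i j : Fin 3) (f : MvPolynomial (Fin 3) ℝ) :
    pderiv i (pderiv j f) = pderiv j (pderiv i f) := by
  have h : ⁅(pderiv i : Derivation ℝ (MvPolynomial (Fin 3) ℝ) (MvPolynomial (Fin 3) ℝ)),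
      (pderiv j : Derivation ℝ (MvPolynomial (Fin 3) ℝ) (MvPolynomial (Fin 3) ℝ))⁆ = 0 := by
    refine derivation_ext fun k => ?_
    simp [Derivation.commutator_apply, pderiv_X, Pi.single_apply, apply_ite]
  have := congrArg (fun D => D f) h
  simpa [Derivation.commutator_apply, sub_eq_zero] using this

/-- A space of complex polynomials closed under the bracket, containing `X₀ ± i X₁` and the ideal
of the sphere of radius `s`. -/
structure IsSphereSubalgebra (s : ℝ) (V : Submodule ℂ (MvPolynomial (Fin 3) ℂ)) : Prop where
  hamiltonian_mem : ∀ {F G}, F ∈ V → G ∈ V → hamiltonian F G ∈ V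
  coordZ_mem : coordZ ∈ V
  coordW_mem : coordW ∈ V
  mul_relation_mem : ∀ F, F * (coordZ * coordW - evalX (sqSub s)) ∈ V

theorem C_mul_mem_iff {V : Submodule ℂ (MvPolynomial (Fin 3) ℂ)} {a : ℂ} (ha : a ≠ 0)
    {F : MvPolynomial (Fin 3) ℂ} : C a * F ∈ V ↔ F ∈ V := by
  rw [← smul_eq_C_mul, V.smul_mem_iff ha]

namespace IsSphereSubalgebra

variable {s : ℝ} {V : Submodule ℂ (MvPolynomial (Fin 3) ℂ)}

theorem mem_of_sub_eq (hV : IsSphereSubalgebra s V) {F G H : MvPolynomial (Fin 3) ℂ} (hF : F ∈ V)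
    (h : G - F = H * (coordZ * coordW - evalX (sqSub s))) : G ∈ V := by
  rw [← sub_add_cancel G F, h]
  exact V.add_mem (hV.mul_relation_mem H) hF

theorem lower_mem (hV : IsSphereSubalgebra s V) {b : ℕ} {q : Polynomial ℝ}
    (h : coordZ ^ (b + 1) * evalX q ∈ V) : coordZ ^ b * evalX (lowering s (b + 1) q) ∈ V := by
  have h' := (C_mul_mem_iff Complex.I_ne_zero).2 (hV.hamiltonian_mem hV.coordW_mem h)
  refine hV.mem_of_sub_eq h' (H := -(coordZ ^ b * evalX (Polynomial.derivative q))) ?_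
  rw [Derivation.leibniz, hamiltonian_evalX, Derivation.leibniz_pow, hamiltonian_coordW_X,
    hamiltonian_coordW_coordZ, evalX_lowering]
  simp only [smul_eq_mul, nsmul_eq_mul, Nat.add_sub_cancel]
  push_cast
  linear_combination (coordZ ^ (b + 1) * evalX (Polynomial.derivative q) * coordW -
    evalX q * (b + 1) * coordZ ^ b * 2 * X 2) * C_I_mul_C_I

theorem raise_mem (hV : IsSphereSubalgebra s V) {b : ℕ} {q : Polynomial ℝ}
    (h : coordZ ^ b * evalX q ∈ V) : coordZ ^ (b + 1) * evalX (Polynomial.derivative q) ∈ V := by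
  have h' := hV.hamiltonian_mem hV.coordZ_mem h
  rw [← C_mul_mem_iff Complex.I_ne_zero]
  convert h' using 1
  rw [Derivation.leibniz, hamiltonian_evalX, Derivation.leibniz_pow, hamiltonian_self,
    hamiltonian_coordZ_X]
  simp only [smul_eq_mul]
  ring

theorem coordW_pow_mem (hV : IsSphereSubalgebra s V) {n : ℕ} {q : Polynomial ℝ}
    (h : coordW ^ n * evalX q ∈ V) : coordW ^ (n + 1) * evalX (Polynomial.derivative q) ∈ V := by
  have h' := hV.hamiltonian_mem hV.coordW_mem h
  rw [← C_mul_mem_iff (neg_ne_zero.2 Complex.I_ne_zero)]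
  convert h' using 1
  rw [Derivation.leibniz, hamiltonian_evalX, Derivation.leibniz_pow, hamiltonian_self,
    hamiltonian_coordW_X]
  simp only [smul_eq_mul, C_neg]
  ring

theorem coordZ_pow_mem_of_symmIntegral_ne_zero (hV : IsSphereSubalgebra s V) {m : ℕ}
    {q : Polynomial ℝ} (h : coordZ ^ (m + 1) * evalX q ∈ V)
    (h0 : symmIntegral s (sqSub s ^ (m + 1) * q) ≠ 0) : coordZ ^ (m + 1) ∈ V := by
  let W : Submodule ℝ (Polynomial ℝ) :=
    (V.restrictScalars ℝ).comap
      (LinearMap.mulLeft ℝ (coordZ ^ (m + 1)) ∘ₗ (Polynomial.aeval (X 2)).toLinearMap)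
  have h1 : (1 : Polynomial ℝ) ∈ W :=
    one_mem_of_derivative_lowering_mem s (m + 1) W
      (fun q hq => hV.raise_mem (hV.lower_mem hq)) h h0
  simpa [W] using h1

theorem exists_coordZ_pow_mul_mem (hV : IsSphereSubalgebra s V) {l : ℕ} (hl : coordZ ^ l ∈ V)
    {b k : ℕ} (h : b + k = l) : ∃ q : Polynomial ℝ, coordZ ^ b * evalX q ∈ V ∧
      sqSub s ^ b * q = Polynomial.derivative^[k] (sqSub s ^ l) := by
  induction k generalizing b with
  | zero => exact ⟨1, by simpa [evalX, ← h] using hl, by simp [← h]⟩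
  | succ k ih =>
    obtain ⟨q, hq, e⟩ := ih (b := b + 1) (by omega)
    refine ⟨lowering s (b + 1) q, hV.lower_mem hq, ?_⟩
    rw [Function.iterate_succ_apply', ← e]
    exact sqSub_pow_mul_lowering s b q

theorem coordW_pow_mul_mem (hV : IsSphereSubalgebra s V) {l : ℕ} (hl : coordZ ^ l ∈ V) (n : ℕ) :
    coordW ^ n * evalX (Polynomial.derivative^[l + n] (sqSub s ^ l)) ∈ V := by
  induction n with
  | zero =>
    obtain ⟨q, hq, e⟩ := hV.exists_coordZ_pow_mul_mem hl (zero_add l)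
    rw [pow_zero, one_mul] at e
    simpa [e] using hq
  | succ n ih =>
    rw [← add_assoc, Function.iterate_succ_apply']
    exact hV.coordW_pow_mem ih

theorem coordZ_pow_mem_of_ge (hV : IsSphereSubalgebra s V) (hs : 0 < s) {b k : ℕ}
    (hl : coordZ ^ (b + k) ∈ V) (hk : Odd k) : coordZ ^ (b + k + b) ∈ V := by
  obtain ⟨q, hq, e⟩ := hV.exists_coordZ_pow_mul_mem hl rfl
  obtain ⟨n, hn⟩ : ∃ n, b + k = n + 1 := Nat.exists_eq_succ_of_ne_zero (by have := hk.pos; omega)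
  have h := hV.hamiltonian_mem hl hq
  have hne : (Complex.I * (b + k : ℕ)) ≠ 0 :=
    mul_ne_zero Complex.I_ne_zero (Nat.cast_ne_zero.2 (by omega))
  have h' : coordZ ^ (b + k + b) * evalX (Polynomial.derivative q) ∈ V := by
    rw [← C_mul_mem_iff hne]
    convert h using 1
    rw [hamiltonian_swap, Derivation.leibniz_pow, hamiltonian_swap, Derivation.leibniz,
      hamiltonian_evalX, Derivation.leibniz_pow, hamiltonian_self, hamiltonian_coordZ_X]
    simp only [smul_eq_mul, nsmul_eq_mul, hn, Nat.add_sub_cancel, C_mul, map_natCast]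
    ring
  rw [show b + k + b = n + b + 1 by omega] at h' ⊢
  refine hV.coordZ_pow_mem_of_symmIntegral_ne_zero h' ?_
  rw [symmIntegral_sqSub_pow_mul_derivative, pow_add, mul_assoc (sqSub s ^ n), e, hn]
  exact mul_ne_zero (by positivity)
    (symmIntegral_X_mul_sqSub_pow_mul_ne_zero hs hk (by omega))

theorem coordZ_pow_mem_of_lt (hV : IsSphereSubalgebra s V) (hs : 0 < s) {m n : ℕ}
    (hl : coordZ ^ (m + 1 + (n + 1)) ∈ V) (hm : Odd (m + 1)) : coordZ ^ (m + 1) ∈ V := by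
  set l := m + 1 + (n + 1) with hl'
  set q := Polynomial.derivative^[l + (n + 1)] (sqSub s ^ l) with hq'
  have hq := hV.coordW_pow_mul_mem hl (n + 1)
  rw [← hq'] at hq
  have h := hV.hamiltonian_mem hl hq
  have hne : (Complex.I * (l : ℕ)) ≠ 0 :=
    mul_ne_zero Complex.I_ne_zero (Nat.cast_ne_zero.2 (by omega))
  rw [hamiltonian_swap, Derivation.leibniz_pow, hamiltonian_swap, Derivation.leibniz,
      hamiltonian_evalX, Derivation.leibniz_pow, hamiltonian_swap coordZ coordW,
      hamiltonian_coordW_coordZ, hamiltonian_coordZ_X] at h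
  have h' : coordZ ^ (m + 1) * evalX (sqSub s ^ n * lowering s (n + 1) q) ∈ V := by
    rw [← C_mul_mem_iff hne]
    obtain ⟨H, hH⟩ := sub_dvd_pow_sub_pow (coordZ * coordW) (evalX (sqSub s)) n
    refine hV.mem_of_sub_eq h (H := -(C Complex.I * (l : MvPolynomial (Fin 3) ℂ) *
      coordZ ^ (m + 1) * (coordZ ^ n * coordW ^ n * evalX (Polynomial.derivative q) +
        H * evalX (lowering s (n + 1) q)))) ?_
    have e : evalX (sqSub s ^ n * lowering s (n + 1) q) =
        evalX (sqSub s) ^ n * evalX (lowering s (n + 1) q) := by simp [evalX]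
    rw [e, evalX_lowering]
    simp only [smul_eq_mul, nsmul_eq_mul, hl', Nat.add_sub_cancel, C_mul, map_natCast,
      show m + 1 + (n + 1) - 1 = m + 1 + n by omega]
    rw [mul_pow] at hH
    push_cast
    linear_combination (-(C Complex.I * (m + 1 + (n + 1)) * coordZ ^ (m + 1) *
      (evalX (sqSub s) * evalX (Polynomial.derivative q) -
      2 * (n + 1) * X 2 * evalX q))) * hH
  refine hV.coordZ_pow_mem_of_symmIntegral_ne_zero h' ?_
  rw [sqSub_pow_mul_lowering, symmIntegral_sqSub_pow_mul_derivative, ← mul_assoc (sqSub s ^ m),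
    ← pow_add, show m + (n + 1) = m + n + 1 by omega, hq', hl',
    show m + 1 + (n + 1) = m + n + 1 + 1 by omega]
  refine mul_ne_zero (by positivity) (symmIntegral_X_mul_sqSub_pow_mul_ne_zero hs ?_ (by omega))
  rw [Nat.odd_iff] at hm ⊢
  omega

theorem coordZ_pow_mem (hV : IsSphereSubalgebra s V) (hs : 0 < s) {l : ℕ}
    (hl : coordZ ^ l ∈ V) {m : ℕ} (hm : Odd m) (hml : m < 2 * l) : coordZ ^ m ∈ V := by
  rcases lt_or_ge m l with h | h
  · obtain ⟨m, rfl⟩ := Nat.exists_eq_succ_of_ne_zero hm.pos.ne'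
    obtain ⟨n, rfl⟩ := Nat.exists_eq_add_of_lt h
    exact hV.coordZ_pow_mem_of_lt hs hl hm
  · obtain ⟨b, rfl⟩ := Nat.exists_eq_add_of_le h
    obtain ⟨k, rfl⟩ := Nat.exists_eq_add_of_le (show b ≤ l by omega)
    refine hV.coordZ_pow_mem_of_ge hs hl ?_
    rw [Nat.odd_iff] at hm ⊢
    omega

theorem coordZ_pow_mul_X_pow_mem (hV : IsSphereSubalgebra s V) {M : ℕ}
    (hM : ∀ m, Odd m → m ≤ M → coordZ ^ m ∈ V) (j : ℕ) : ∀ b, Odd (b + j) → b + j ≤ M →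
      coordZ ^ b * evalX (Polynomial.X ^ j) ∈ V := by
  induction j using Nat.strong_induction_on with
  | _ j ih =>
    intro b hb hbM
    rcases j with _ | j
    · simpa [evalX] using hM b hb hbM
    have h := hV.lower_mem (ih j (by omega) (b + 1) (by convert hb using 1; omega) (by omega))
    have h2 : ((s ^ 2 * j : ℝ)) • (coordZ ^ b * evalX (Polynomial.X ^ (j - 1))) ∈
        V.restrictScalars ℝ := by
      rcases j with _ | j
      · simp
      · refine Submodule.smul_mem _ _ (ih j (by omega) b ?_ (by omega))
        rw [Nat.odd_iff] at hb ⊢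
        omega
    have e : lowering s (b + 1) (Polynomial.X ^ j) =
        (s ^ 2 * j : ℝ) • Polynomial.X ^ (j - 1) -
          (2 * (b + 1) + j : ℝ) • Polynomial.X ^ (j + 1) := by
      rw [lowering, sqSub]
      simp only [Polynomial.derivative_X_pow, Polynomial.smul_eq_C_mul]
      rcases j with _ | j
      · simp
      · simp
        ring
    rw [e, evalX, map_sub,
      map_smul, map_smul, mul_sub, mul_smul_comm, mul_smul_comm] at h
    have h3 := (V.restrictScalars ℝ).sub_mem h2 h
    rw [evalX, sub_sub_cancel] at h3
    exact ((V.restrictScalars ℝ).smul_mem_iff (by positivity)).1 h3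

theorem coordW_pow_mul_X_pow_mem (hV : IsSphereSubalgebra s V) {M : ℕ}
    (hM : ∀ m, Odd m → m ≤ M → coordZ ^ m ∈ V) (n : ℕ) : ∀ j, Odd (n + j) → n + j ≤ M →
      coordW ^ n * evalX (Polynomial.X ^ j) ∈ V := by
  induction n with
  | zero => simpa using fun j => hV.coordZ_pow_mul_X_pow_mem hM j 0
  | succ n ih =>
    intro j hj hjM
    have h := hV.coordW_pow_mem (ih (j + 1) (by convert hj using 1; omega) (by omega))
    rw [Polynomial.derivative_X_pow_succ, evalX, map_mul, Polynomial.aeval_C,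
      ← Algebra.smul_def, mul_smul_comm] at h
    exact ((V.restrictScalars ℝ).smul_mem_iff (by positivity)).1 h

theorem coord_monomial_mem (hV : IsSphereSubalgebra s V) {M : ℕ}
    (hM : ∀ m, Odd m → m ≤ M → coordZ ^ m ∈ V) (a : ℕ) : ∀ b c, Odd (a + b + c) → a + b + c ≤ M →
      coordZ ^ a * coordW ^ b * X 2 ^ c ∈ V := by
  induction a with
  | zero =>
    intro b c h1 h2
    rw [zero_add] at h1 h2
    simpa [evalX_X_pow] using hV.coordW_pow_mul_X_pow_mem hM b c h1 h2
  | succ a ih =>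
    intro b c h1 h2
    rcases b with _ | b
    · simpa [evalX_X_pow] using hV.coordZ_pow_mul_X_pow_mem hM c (a + 1) h1 h2
    · rw [Nat.odd_iff] at h1
      have h3 := (V.restrictScalars ℝ).smul_mem (s ^ 2)
        (ih b c (by rw [Nat.odd_iff]; omega) (by omega))
      have h4 := ih b (c + 2) (by rw [Nat.odd_iff]; omega) (by omega)
      refine hV.mem_of_sub_eq (V.sub_mem h3 h4) (H := coordZ ^ a * coordW ^ b * X 2 ^ c) ?_
      rw [real_smul_eq_C_mul, evalX_sqSub]
      ring

theorem mul_X_pow_mem (hV : IsSphereSubalgebra s V) {M : ℕ}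
    (hM : ∀ m, Odd m → m ≤ M → coordZ ^ m ∈ V) (j c : ℕ) : ∀ a b, Odd (a + b + c + j) →
      a + b + c + j ≤ M → coordZ ^ a * coordW ^ b * X 2 ^ c * X 1 ^ j ∈ V := by
  induction j with
  | zero => simpa using fun a b => hV.coord_monomial_mem hM a b c
  | succ j ih =>
    intro a b h1 h2
    have h3 := ih (a + 1) b (by convert h1 using 1; omega) (by omega)
    have h4 := ih a (b + 1) (by convert h1 using 1; omega) (by omega)
    rw [← C_mul_mem_iff (mul_ne_zero two_ne_zero Complex.I_ne_zero)]
    convert V.sub_mem h3 h4 using 1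
    rw [C_mul, coordZ, coordW, show (C 2 : MvPolynomial (Fin 3) ℂ) = 2 from rfl]
    ring

theorem monomial_mem (hV : IsSphereSubalgebra s V) {M : ℕ}
    (hM : ∀ m, Odd m → m ≤ M → coordZ ^ m ∈ V) (i j c : ℕ) : ∀ a b, Odd (a + b + c + j + i) →
      a + b + c + j + i ≤ M → coordZ ^ a * coordW ^ b * X 2 ^ c * X 1 ^ j * X 0 ^ i ∈ V := by
  induction i with
  | zero => simpa using hV.mul_X_pow_mem hM j c
  | succ i ih =>
    intro a b h1 h2
    have h3 := ih (a + 1) b (by convert h1 using 1; omega) (by omega)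
    have h4 := ih a (b + 1) (by convert h1 using 1; omega) (by omega)
    rw [← C_mul_mem_iff (two_ne_zero (α := ℂ))]
    convert V.add_mem h3 h4 using 1
    rw [coordZ, coordW, show (C 2 : MvPolynomial (Fin 3) ℂ) = 2 from rfl]
    ring

theorem isHomogeneous_mem (hV : IsSphereSubalgebra s V) {M : ℕ}
    (hM : ∀ m, Odd m → m ≤ M → coordZ ^ m ∈ V) {m : ℕ} (hm : Odd m) (hmM : m ≤ M)
    {F : MvPolynomial (Fin 3) ℂ} (hF : F.IsHomogeneous m) : F ∈ V := by
  rw [F.as_sum]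
  refine V.sum_mem fun d hd => ?_
  have hdeg : d 0 + d 1 + d 2 = m := by
    rw [← hF (mem_support_iff.1 hd), Finsupp.weight_apply, Finsupp.sum_fintype _ _ (by simp),
      Fin.sum_univ_three]
    simp
  rw [monomial_eq, ← smul_eq_C_mul, Finsupp.prod_fintype _ _ (by simp), Fin.prod_univ_three]
  refine V.smul_mem _ ?_
  have e : 0 + 0 + d 2 + d 1 + d 0 = m := by omega
  convert hV.monomial_mem hM (d 0) (d 1) (d 2) 0 0 (by rwa [e]) (by rwa [e]) using 1
  ring

end IsSphereSubalgebra

theorem pb_mul_relation (s : ℝ) (f g : MvPolynomial (Fin 3) ℝ) :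
    pb (f * (X 0 ^ 2 + X 1 ^ 2 + X 2 ^ 2 - C (s ^ 2))) g =
      pb f g * (X 0 ^ 2 + X 1 ^ 2 + X 2 ^ 2 - C (s ^ 2)) := by
  simp only [pb, Derivation.leibniz, map_add, map_sub, Derivation.leibniz_pow, pderiv_C, pderiv_X]
  simp
  ring

theorem pb_swap (f g : MvPolynomial (Fin 3) ℝ) : pb f g = -pb g f := by
  simp only [pb]
  ring

theorem pb_sub_left (f f' g : MvPolynomial (Fin 3) ℝ) : pb (f - f') g = pb f g - pb f' g := by
  simp only [pb, map_sub]
  ring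

theorem toSphere_pb_congr_left {s : ℝ} {f f' : MvPolynomial (Fin 3) ℝ}
    (h : toSphere s f = toSphere s f') (g : MvPolynomial (Fin 3) ℝ) :
    toSphere s (pb f g) = toSphere s (pb f' g) := by
  rw [toSphere, Ideal.Quotient.eq, sphereIdeal, Ideal.mem_span_singleton'] at h ⊢
  obtain ⟨a, ha⟩ := h
  exact ⟨pb a g, by rw [← pb_mul_relation, ha, pb_sub_left]⟩

theorem toSphere_rep (s : ℝ) (p : SpherePoly s) : toSphere s (rep s p) = p :=
  (Ideal.Quotient.mk_surjective (I := sphereIdeal s) p).choose_spec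

theorem pbS_toSphere (s : ℝ) (f g : MvPolynomial (Fin 3) ℝ) :
    pbS s (toSphere s f) (toSphere s g) = toSphere s (pb f g) := by
  rw [pbS, toSphere_pb_congr_left (toSphere_rep s _), pb_swap, map_neg,
    toSphere_pb_congr_left (toSphere_rep s _), ← map_neg, ← pb_swap]

/-- The real and imaginary parts of `(X₀ + i X₁)ⁿ` are harmonic, by the Cauchy-Riemann
equations. -/
theorem coordZ_pow_eq (n : ℕ) : ∃ f ∈ harmonicHomog n, ∃ g ∈ harmonicHomog n,
    coordZ ^ n = map Complex.ofRealHom f + C Complex.I * map Complex.ofRealHom g := by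
  suffices ∃ f g : MvPolynomial (Fin 3) ℝ, f.IsHomogeneous n ∧ g.IsHomogeneous n ∧
      (pderiv 0 f = pderiv 1 g ∧ pderiv 1 f = -pderiv 0 g ∧ pderiv 2 f = 0 ∧ pderiv 2 g = 0) ∧
      coordZ ^ n = map Complex.ofRealHom f + C Complex.I * map Complex.ofRealHom g by
    obtain ⟨f, g, hf, hg, ⟨h0, h1, h2, h3⟩, e⟩ := this
    refine ⟨f, ⟨hf, ?_⟩, g, ⟨hg, ?_⟩, e⟩
    · simp [laplacian, h0, h1, h2, pderiv_pderiv_comm 0 1]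
    · simp [laplacian, ← h0, show pderiv 0 g = -pderiv 1 f by rw [h1, neg_neg], h3,
        pderiv_pderiv_comm 0 1]
  induction n with
  | zero => exact ⟨1, 0, isHomogeneous_one _ _, isHomogeneous_zero _ _ _, by simp, by simp⟩
  | succ n ih =>
    obtain ⟨f, g, hf, hg, ⟨h0, h1, h2, h3⟩, e⟩ := ih
    refine ⟨X 0 * f - X 1 * g, X 0 * g + X 1 * f, ?_, ?_, ⟨?_, ?_, ?_, ?_⟩, ?_⟩
    · rw [add_comm n]
      exact ((isHomogeneous_X _ _).mul hf).sub ((isHomogeneous_X _ _).mul hg)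
    · rw [add_comm n]
      exact ((isHomogeneous_X _ _).mul hg).add ((isHomogeneous_X _ _).mul hf)
    · simp [pderiv_X, h0, h1]; ring
    · simp [pderiv_X, h0, h1]; ring
    · simp [pderiv_X, h2, h3]
    · simp [pderiv_X, h2, h3]
    · rw [pow_succ, e, coordZ]
      simp only [map_sub, map_add, map_mul, map_X]
      linear_combination X 1 * map Complex.ofRealHom g * C_I_mul_C_I

/-- Lemma 2.6: if `l ≥ 3` is odd and `R` is a Poisson subalgebra of `P` containing `H₁`
and `H_l`, then `R` contains `H_m` for every odd `m` with `1 ≤ m ≤ 2l - 1`, i.e. all odd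
polynomials of degree at most `2l - 1`. -/
theorem odd_polys_le (s : ℝ) (hs : 0 < s) (l : ℕ) (hl3 : 3 ≤ l) (hlodd : Odd l)
    (R : Submodule ℝ (SpherePoly s))
    (hpoisson : ∀ p ∈ R, ∀ q ∈ R, pbS s p q ∈ R)
    (hH1 : Hsph s 1 ≤ R) (hHl : Hsph s l ≤ R) :
    ∀ m : ℕ, Odd m → 1 ≤ m → m ≤ 2 * l - 1 → Hsph s m ≤ R := by
  intro m hm _ hml
  set T : Submodule ℝ (MvPolynomial (Fin 3) ℝ) :=
    R.comap (Ideal.Quotient.mkₐ ℝ (sphereIdeal s)).toLinearMap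
  have hT : ∀ f ∈ T, ∀ g ∈ T, pb f g ∈ T := fun f hf g hg => by
    have : pbS s (toSphere s f) (toSphere s g) ∈ R := hpoisson _ hf _ hg
    rwa [pbS_toSphere] at this
  have hX (i : Fin 3) : X i ∈ T := hH1 (S_mem_H1 s i)
  have hrel (f : MvPolynomial (Fin 3) ℝ) :
      f * (X 0 ^ 2 + X 1 ^ 2 + X 2 ^ 2 - C (s ^ 2)) ∈ T := by
    have : toSphere s (f * (X 0 ^ 2 + X 1 ^ 2 + X 2 ^ 2 - C (s ^ 2))) = 0 :=
      Ideal.Quotient.eq_zero_iff_mem.2 (Ideal.mul_mem_left _ _ (Ideal.mem_span_singleton_self _))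
    exact Submodule.mem_comap.2 (this.symm ▸ R.zero_mem)
  have hV : IsSphereSubalgebra s (complexify T) :=
    { hamiltonian_mem := hamiltonian_mem_complexify hT
      coordZ_mem := ⟨X 0, hX 0, X 1, hX 1, by simp [coordZ]⟩
      coordW_mem := ⟨X 0, hX 0, -X 1, T.neg_mem (hX 1), by simp [coordW, sub_eq_add_neg]⟩
      mul_relation_mem := fun F => by
        rw [coordZ_mul_coordW_sub]
        exact mul_map_mem_complexify hrel F }
  have hH : harmonicHomog l ≤ T := Submodule.map_le_iff_le_comap.1 hHl
  have hl : coordZ ^ l ∈ complexify T := by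
    obtain ⟨f, hf, g, hg, e⟩ := coordZ_pow_eq l
    exact ⟨f, hH hf, g, hH hg, e⟩
  refine Submodule.map_le_iff_le_comap.2 fun f hf => map_mem_complexify.1 ?_
  exact hV.isHomogeneous_mem (fun k hk hkl => hV.coordZ_pow_mem hs hl hk (by omega)) hm hml
    (IsHomogeneous.map hf.1 _)

end
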